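/- arXiv:math/0703392 — 4 statements merged into one kernel-verified Lean document; each statement's English description precedes it below -/
import Mathlib

section
/- Fix a prime number p, a real number λ ∈ (1,p], and a real number β > 1. Then the partition function satisfies the closed formula Z_p(λ,β) = 2 (1 − p^{−β})/(1 − p^{1−β}) · f_p(λ,β). -/
/-- `a p lam k = ⌈lam * p^k - 1⌉`, the number of positive integers in `(0, lam·p^k)`. -/
noncomputable def a (p : ℕ) (lam : ℝ) (k : ℤ) : ℤ := ⌈lam * (p : ℝ) ^ k - 1⌉

/-- The partition function `Z_p(λ,β) = 2 Σ_{k≥0} (a_k(λ) − a_{k−1}(λ)) p^{−kβ}`. -/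
noncomputable def Z (p : ℕ) (lam β : ℝ) : ℝ :=
  2 * ∑' k : ℕ, ((a p lam (k : ℤ) - a p lam ((k : ℤ) - 1) : ℤ) : ℝ) * (p : ℝ) ^ (-(k : ℝ) * β)

/-- The base-`p` digits `c_k(λ) = a_k(λ) − p·a_{k−1}(λ)` of `λ ∈ (1,p]`. -/
noncomputable def c (p : ℕ) (lam : ℝ) (k : ℕ) : ℤ :=
  a p lam (k : ℤ) - p * a p lam ((k : ℤ) - 1)

/-- `f_p(λ,β) = Σ_{k≥0} c_k(λ) p^{−kβ}`. -/
noncomputable def f (p : ℕ) (lam β : ℝ) : ℝ :=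
  ∑' k : ℕ, ((c p lam k : ℤ) : ℝ) * (p : ℝ) ^ (-(k : ℝ) * β)

/-- Since `λ ∈ (1,p]`, there is no positive integer below `λ / p`. -/
lemma a_neg_one {p : ℕ} {lam : ℝ} (h1 : 1 < lam) (h2 : lam ≤ p) : a p lam (-1) = 0 := by
  have hp : (0 : ℝ) < p := by linarith
  rw [a, Int.ceil_eq_zero_iff, zpow_neg_one, ← div_eq_mul_inv]
  have hpos : 0 < lam / p := by positivity
  have hle : lam / p ≤ 1 := (div_le_one hp).2 h2
  constructor <;> linarith

lemma abs_a_le {p : ℕ} {lam : ℝ} (h1 : 1 < lam) (h2 : lam ≤ p) (k : ℕ) :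
    |(a p lam k : ℝ)| ≤ lam * (p : ℝ) ^ k := by
  have hp : (1 : ℝ) ≤ p := by linarith
  have hpk : (1 : ℝ) ≤ (p : ℝ) ^ k := one_le_pow₀ hp
  have hlo := Int.le_ceil (lam * (p : ℝ) ^ k - 1)
  have hhi := Int.ceil_lt_add_one (lam * (p : ℝ) ^ k - 1)
  rw [a, zpow_natCast, abs_le]
  constructor <;> nlinarith

lemma summable_a_mul_pow {p : ℕ} {lam x : ℝ} (h1 : 1 < lam) (h2 : lam ≤ p) (hx : 0 ≤ x)
    (hpx : p * x < 1) : Summable fun k : ℕ => (a p lam k : ℝ) * x ^ k := by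
  refine Summable.of_norm_bounded
    ((summable_geometric_of_lt_one (by positivity) hpx).mul_left lam) fun k => ?_
  rw [norm_mul, Real.norm_eq_abs, Real.norm_of_nonneg (pow_nonneg hx k), mul_pow, ← mul_assoc]
  exact mul_le_mul_of_nonneg_right (abs_a_le h1 h2 k) (pow_nonneg hx k)

/-- Multiplying the generating series of `u` by `1 - r x` replaces `u k` by `u k - r u (k - 1)`. -/
lemma tsum_sub_mul_shift {u : ℤ → ℝ} {x : ℝ} (hu : u (-1) = 0)
    (hs : Summable fun k : ℕ => u k * x ^ k) (r : ℝ) :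
    ∑' k : ℕ, (u k - r * u ((k : ℤ) - 1)) * x ^ k = (1 - r * x) * ∑' k : ℕ, u k * x ^ k := by
  have hstep : ∀ k : ℕ, r * u (((k + 1 : ℕ) : ℤ) - 1) * x ^ (k + 1) = r * x * (u k * x ^ k) := by
    intro k
    rw [Nat.cast_succ, add_sub_cancel_right]
    ring
  have hshift : Summable fun k : ℕ => r * u ((k : ℤ) - 1) * x ^ k := by
    rw [← summable_nat_add_iff 1]
    simpa only [hstep] using hs.mul_left (r * x)
  have hsum : ∑' k : ℕ, r * u ((k : ℤ) - 1) * x ^ k = r * x * ∑' k : ℕ, u k * x ^ k := by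
    rw [hshift.tsum_eq_zero_add]
    simp only [hstep, tsum_mul_left]
    simp [hu]
  simp only [sub_mul]
  rw [hs.tsum_sub hshift, hsum, one_mul]

/-- For a prime `p`, `λ ∈ (1,p]` and `β > 1`, the partition function satisfies the closed
formula `Z_p(λ,β) = 2 (1 − p^{−β})/(1 − p^{1−β}) · f_p(λ,β)`. -/
theorem Z_eq_closed_formula
    (p : ℕ) (hp : p.Prime) (lam : ℝ) (h1 : 1 < lam) (h2 : lam ≤ p) (β : ℝ) (hβ : 1 < β) :
    Z p lam β = 2 * (1 - (p : ℝ) ^ (-β)) / (1 - (p : ℝ) ^ ((1 : ℝ) - β)) * f p lam β := by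
  have hp0 : (0 : ℝ) < p := by linarith
  have hp1 : (1 : ℝ) < p := by linarith
  have hpow : ∀ k : ℕ, (p : ℝ) ^ (-(k : ℝ) * β) = ((p : ℝ) ^ (-β)) ^ k := fun k => by
    rw [← Real.rpow_mul_natCast hp0.le]
    ring_nf
  have hone : (p : ℝ) ^ (1 - β) = p * (p : ℝ) ^ (-β) := by
    rw [sub_eq_add_neg, Real.rpow_add hp0, Real.rpow_one]
  have hlt : (p : ℝ) * (p : ℝ) ^ (-β) < 1 :=
    hone ▸ Real.rpow_lt_one_of_one_lt_of_neg hp1 (by linarith)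
  have hs := summable_a_mul_pow h1 h2 (Real.rpow_nonneg hp0.le (-β)) hlt
  have key := tsum_sub_mul_shift (u := fun k => (a p lam k : ℝ))
    (by simp [a_neg_one h1 h2]) hs
  have hZ := key 1
  have hf := key p
  simp only [one_mul] at hZ
  simp only [Z, f, c, hpow, hone, Int.cast_sub, Int.cast_mul, Int.cast_natCast]
  rw [hZ, hf]
  have hne : 1 - (p : ℝ) * (p : ℝ) ^ (-β) ≠ 0 := by linarith
  rw [div_mul_eq_mul_div, eq_div_iff hne]
  ring
end

section
/- Fix a prime number p and a real number β > 1. Then the function λ ↦ Z_p(λ,β) on (1,p] is continuous on the left at every point (i.e. for every λ₀ ∈ (1,p], Z_p(λ,β) → Z_p(λ₀,β) as λ → λ₀ from below within (1,p]) and is lower semicontinuous on (1,p]. -/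
lemma a_nonneg {p : ℕ} (hp : p.Prime) {lam : ℝ} (h : 0 < lam) (k : ℤ) : 0 ≤ a p lam k := by
  have hp0 : (0 : ℝ) < p := by exact_mod_cast hp.pos
  have h1 : 0 < lam * (p : ℝ) ^ k := by positivity
  have : -1 < a p lam k := by
    unfold a
    rw [Int.lt_ceil]
    push_cast
    linarith
  omega

lemma a_mono {p : ℕ} {lam mu : ℝ} (h : lam ≤ mu) (k : ℤ) : a p lam k ≤ a p mu k := by
  unfold a
  gcongr

lemma a_le {p : ℕ} {lam : ℝ} (h : lam ≤ p) (k : ℤ) : (a p lam k : ℝ) ≤ p * (p : ℝ) ^ k := by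
  have h1 : (a p lam k : ℝ) < lam * (p : ℝ) ^ k - 1 + 1 := Int.ceil_lt_add_one _
  have h2 : lam * (p : ℝ) ^ k ≤ p * (p : ℝ) ^ k := by gcongr
  linarith

lemma a_neg_one_s10 {p : ℕ} (hp : p.Prime) {lam : ℝ} (h : 0 < lam) (h' : lam ≤ p) :
    a p lam (-1) = 0 := by
  have hp0 : (0 : ℝ) < p := by exact_mod_cast hp.pos
  have h1 := a_le h' (-1)
  rw [zpow_neg_one, mul_inv_cancel₀ hp0.ne'] at h1
  refine le_antisymm ?_ (a_nonneg hp h _)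
  unfold a
  rw [Int.ceil_le, zpow_neg_one, ← div_eq_mul_inv]
  have : lam / p ≤ 1 := (div_le_one hp0).2 h'
  push_cast
  linarith

/-- The ceiling function is left continuous, hence so is `lam ↦ a p lam k`: it is
locally constant on the left of each point. -/
lemma eventually_a_eq (p : ℕ) (lam₀ : ℝ) (k : ℤ) :
    ∀ᶠ lam in nhdsWithin lam₀ (Set.Iio lam₀), a p lam k = a p lam₀ k := by
  have hc : Filter.Tendsto (fun lam : ℝ => lam * (p : ℝ) ^ k - 1)
      (nhdsWithin lam₀ (Set.Iio lam₀)) (nhds (lam₀ * (p : ℝ) ^ k - 1)) := by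
    apply Filter.Tendsto.mono_left _ nhdsWithin_le_nhds
    apply Continuous.tendsto
    fun_prop
  have h1 : ((a p lam₀ k - 1 : ℤ) : ℝ) < lam₀ * (p : ℝ) ^ k - 1 := by
    rw [← Int.lt_ceil]
    exact Int.sub_one_lt_of_le le_rfl
  filter_upwards [hc.eventually_const_lt h1, self_mem_nhdsWithin] with lam h2 h3
  refine le_antisymm (a_mono (le_of_lt h3) k) ?_
  rw [← Int.lt_ceil] at h2
  change a p lam₀ k - 1 < a p lam k at h2
  omega

lemma rpow_neg_natCast_mul (p : ℕ) (β : ℝ) (k : ℕ) :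
    (p : ℝ) ^ (-(k : ℝ) * β) = ((p : ℝ) ^ (-β)) ^ k := by
  rw [← Real.rpow_mul_natCast (Nat.cast_nonneg p)]
  congr 1
  ring

lemma summable_pow_mul {p : ℕ} (hp : p.Prime) {β : ℝ} (hβ : 1 < β) :
    Summable fun k : ℕ => (p : ℝ) ^ (k : ℤ) * ((p : ℝ) ^ (-β)) ^ k := by
  have hp1 : (1 : ℝ) < p := by exact_mod_cast hp.one_lt
  have hp0 : (0 : ℝ) < p := by linarith
  simp_rw [zpow_natCast, ← mul_pow]
  refine summable_geometric_of_lt_one (by positivity) ?_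
  nth_rewrite 1 [← Real.rpow_one (p : ℝ)]
  rw [← Real.rpow_add hp0]
  exact Real.rpow_lt_one_of_one_lt_of_neg hp1 (by linarith)

lemma summable_a {p : ℕ} (hp : p.Prime) {β : ℝ} (hβ : 1 < β) {lam : ℝ} (h : 0 < lam)
    (h' : lam ≤ p) : Summable fun k : ℕ => (a p lam k : ℝ) * ((p : ℝ) ^ (-β)) ^ k := by
  refine Summable.of_nonneg_of_le (fun k => ?_) (fun k => ?_)
    ((summable_pow_mul hp hβ).mul_left (p : ℝ))
  · have : (0 : ℝ) ≤ a p lam k := by exact_mod_cast a_nonneg hp h k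
    positivity
  · rw [← mul_assoc]
    have := a_le h' (k : ℤ)
    gcongr

/-- Summation by parts for the partition function. -/
lemma Z_eq {p : ℕ} (hp : p.Prime) {β : ℝ} (hβ : 1 < β) {lam : ℝ} (h : 0 < lam) (h' : lam ≤ p) :
    Z p lam β =
      2 * ((1 - (p : ℝ) ^ (-β)) * ∑' k : ℕ, (a p lam k : ℝ) * ((p : ℝ) ^ (-β)) ^ k) := by
  have hs := summable_a hp hβ h h'
  have hshift : HasSum (fun k : ℕ => (a p lam ((k : ℤ) - 1) : ℝ) * ((p : ℝ) ^ (-β)) ^ k)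
      ((p : ℝ) ^ (-β) * ∑' k : ℕ, (a p lam k : ℝ) * ((p : ℝ) ^ (-β)) ^ k) := by
    rw [← hasSum_nat_add_iff' 1]
    convert hs.hasSum.mul_left ((p : ℝ) ^ (-β)) using 1
    · rfl
    · ext k
      push_cast
      rw [add_sub_cancel_right, pow_succ]
      ring
    · simp [a_neg_one_s10 hp h h']
  unfold Z
  simp_rw [rpow_neg_natCast_mul]
  congr 1
  rw [sub_mul, one_mul, ← (hs.hasSum.sub hshift).tsum_eq]
  congr 1
  ext k
  push_cast
  ring

lemma Z_mono {p : ℕ} (hp : p.Prime) {β : ℝ} (hβ : 1 < β) :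
    MonotoneOn (fun lam => Z p lam β) (Set.Ioc 0 (p : ℝ)) := by
  intro lam hl mu hm hlm
  have hp1 : (1 : ℝ) < p := by exact_mod_cast hp.one_lt
  have hx : 0 ≤ 1 - (p : ℝ) ^ (-β) := by
    linarith [Real.rpow_lt_one_of_one_lt_of_neg hp1 (show -β < 0 by linarith)]
  simp only [Z_eq hp hβ hl.1 hl.2, Z_eq hp hβ hm.1 hm.2]
  refine mul_le_mul_of_nonneg_left (mul_le_mul_of_nonneg_left ?_ hx) zero_le_two
  refine (summable_a hp hβ hl.1 hl.2).tsum_le_tsum (fun k => ?_) (summable_a hp hβ hm.1 hm.2)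
  have : (a p lam k : ℝ) ≤ a p mu k := by exact_mod_cast a_mono hlm k
  gcongr

lemma tendsto_Z_left {p : ℕ} (hp : p.Prime) {β : ℝ} (hβ : 1 < β) {lam₀ : ℝ} (h : 0 < lam₀)
    (h' : lam₀ ≤ p) :
    Filter.Tendsto (fun lam => Z p lam β) (nhdsWithin lam₀ (Set.Iio lam₀))
      (nhds (Z p lam₀ β)) := by
  have hpos : ∀ᶠ lam : ℝ in nhdsWithin lam₀ (Set.Iio lam₀), 0 < lam ∧ lam ≤ (p : ℝ) := by
    filter_upwards [self_mem_nhdsWithin, nhdsWithin_le_nhds (lt_mem_nhds h)] with lam h1 h2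
    exact ⟨h2, (le_of_lt h1).trans h'⟩
  have key : Filter.Tendsto
      (fun lam => ∑' k : ℕ, (a p lam k : ℝ) * ((p : ℝ) ^ (-β)) ^ k)
      (nhdsWithin lam₀ (Set.Iio lam₀))
      (nhds (∑' k : ℕ, (a p lam₀ k : ℝ) * ((p : ℝ) ^ (-β)) ^ k)) := by
    refine tendsto_tsum_of_dominated_convergence ((summable_pow_mul hp hβ).mul_left (p : ℝ))
      (fun k => ?_) ?_
    · refine tendsto_const_nhds.congr' ?_
      filter_upwards [eventually_a_eq p lam₀ k] with lam hl
      rw [hl]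
    · filter_upwards [hpos] with lam hl k
      have h0 : (0 : ℝ) ≤ a p lam k := by exact_mod_cast a_nonneg hp hl.1 k
      rw [Real.norm_of_nonneg (by positivity), ← mul_assoc]
      have := a_le hl.2 (k : ℤ)
      gcongr
  rw [Z_eq hp hβ h h']
  refine ((key.const_mul (1 - (p : ℝ) ^ (-β))).const_mul 2).congr' ?_
  filter_upwards [hpos] with lam hl
  rw [Z_eq hp hβ hl.1 hl.2]

/-- For a prime `p` and `β > 1`, the partition function `λ ↦ Z_p(λ,β)` is continuous on
the left at every point of `(1,p]` and is lower semicontinuous on `(1,p]`. -/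
theorem Z_left_continuous_and_lsc (p : ℕ) (hp : p.Prime) (β : ℝ) (hβ : 1 < β) :
    (∀ lam₀ : ℝ, 1 < lam₀ → lam₀ ≤ p →
      Filter.Tendsto (fun lam => Z p lam β) (nhdsWithin lam₀ (Set.Ioo 1 lam₀))
        (nhds (Z p lam₀ β))) ∧
    LowerSemicontinuousOn (fun lam => Z p lam β) (Set.Ioc 1 (p : ℝ)) := by
  refine ⟨fun lam₀ h h' => (tendsto_Z_left hp hβ (by linarith) h').mono_left
    (nhdsWithin_mono _ Set.Ioo_subset_Iio_self), ?_⟩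
  intro lam₀ hl y hy
  have h0 : 0 < lam₀ := zero_lt_one.trans hl.1
  have hleft := (tendsto_Z_left hp hβ h0 hl.2).eventually_const_lt hy
  rw [eventually_nhdsWithin_iff] at hleft ⊢
  filter_upwards [hleft] with lam h1 h2
  rcases lt_or_ge lam lam₀ with h3 | h3
  · exact h1 h3
  · exact hy.trans_le (Z_mono hp hβ ⟨h0, hl.2⟩ ⟨zero_lt_one.trans h2.1, h2.2⟩ h3)
end

section
/- Let η : ℝ → ℝ be η(x) = π x² (π x² − 3/2) e^{−π x²}. Then: (i) for every integer n ≥ 1, ∫₀^∞ η(nλ) dλ = 0; (ii) Σ_{n=1}^∞ ∫₀^∞ |η(nλ)| dλ = ∞; (iii) the function λ ↦ Σ_{n=1}^∞ η(nλ) is integrable on (0,∞) and ∫₀^∞ (Σ_{n=1}^∞ η(nλ)) dλ ≠ 0. In particular, the interchange of sum and integral (Fubini) fails: the termwise integrals all vanish while the integral of the sum does not. -/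
open MeasureTheory

/-- The Schwartz function `η(x) = π x² (π x² − 3/2) e^{−π x²}`. -/
noncomputable def η (x : ℝ) : ℝ :=
  Real.pi * x ^ 2 * (Real.pi * x ^ 2 - 3 / 2) * Real.exp (-Real.pi * x ^ 2)

open Set Filter Topology

/-- On one mesh cell, a right-endpoint rectangle approximates the integral up to the mesh size
times the total variation. -/
lemma abs_rectangle_sub_integral_le {f f' : ℝ → ℝ} (hf : ∀ x, HasDerivAt f (f' x) x)
    (hf' : Continuous f') {a b : ℝ} (hab : a ≤ b) :
    |(b - a) * f b - ∫ x in a..b, f x| ≤ (b - a) * ∫ x in a..b, |f' x| := by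
  have hfc : Continuous f := continuous_iff_continuousAt.2 fun x => (hf x).continuousAt
  have key : ∫ x in a..b, (x - a) * f' x = (b - a) * f b - ∫ x in a..b, f x := by
    have := intervalIntegral.integral_mul_deriv_eq_deriv_mul (a := a) (b := b)
      (u := fun x => x - a) (v := f) (u' := fun _ => 1) (v' := f')
      (fun x _ => (hasDerivAt_id x).sub_const a) (fun x _ => hf x)
      intervalIntegrable_const (hf'.intervalIntegrable a b)
    simpa using this
  rw [← key, ← intervalIntegral.integral_const_mul]
  refine (intervalIntegral.abs_integral_le_integral_abs hab).trans
    (intervalIntegral.integral_mono_on hab ?_ ?_ fun x hx => ?_)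
  · exact Continuous.intervalIntegrable (by fun_prop) _ _
  · exact Continuous.intervalIntegrable (by fun_prop) _ _
  · rw [abs_mul, abs_of_nonneg (sub_nonneg.2 hx.1)]
    gcongr
    exact hx.2

/-- A right-endpoint Riemann sum over `(0, ∞)` approximates the integral up to the mesh size
times the total variation. -/
lemma abs_mul_tsum_sub_integral_Ioi_le {f f' : ℝ → ℝ} (hf : ∀ x, HasDerivAt f (f' x) x)
    (hf' : Continuous f') (hfi : IntegrableOn f (Ioi 0)) (hfi' : IntegrableOn f' (Ioi 0))
    {h : ℝ} (hh : 0 < h) (hs : Summable fun n : ℕ => f (((n : ℝ) + 1) * h)) :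
    |h * ∑' n : ℕ, f (((n : ℝ) + 1) * h) - ∫ x in Ioi 0, f x|
      ≤ h * ∫ x in Ioi 0, |f' x| := by
  have hfc : Continuous f := continuous_iff_continuousAt.2 fun x => (hf x).continuousAt
  have hmesh : Tendsto (fun N : ℕ => (N : ℝ) * h) atTop atTop :=
    tendsto_natCast_atTop_atTop.atTop_mul_const hh
  have hbound (N : ℕ) : |h * ∑ n ∈ Finset.range N, f (((n : ℝ) + 1) * h)
      - ∫ x in (0 : ℝ)..N * h, f x| ≤ h * ∫ x in (0 : ℝ)..N * h, |f' x| := by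
    induction N with
    | zero => simp
    | succ N ih =>
      have hcell := abs_rectangle_sub_integral_le hf hf'
        (show (N : ℝ) * h ≤ ((N : ℝ) + 1) * h by nlinarith)
      rw [show ((N : ℝ) + 1) * h - N * h = h by ring] at hcell
      push_cast
      rw [Finset.sum_range_succ,
        ← intervalIntegral.integral_add_adjacent_intervals (b := (N : ℝ) * h)
          (hfc.intervalIntegrable _ _) (hfc.intervalIntegrable _ _),
        ← intervalIntegral.integral_add_adjacent_intervals (b := (N : ℝ) * h)
          (hf'.abs.intervalIntegrable _ _) (hf'.abs.intervalIntegrable _ _)]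
      rw [abs_le] at *
      constructor <;> linarith [ih.1, ih.2, hcell.1, hcell.2]
  refine le_of_tendsto_of_tendsto' (((hs.hasSum.tendsto_sum_nat.const_mul h).sub
    (intervalIntegral_tendsto_integral_Ioi 0 hfi hmesh)).abs)
    ((intervalIntegral_tendsto_integral_Ioi 0 hfi'.abs hmesh).const_mul h) hbound

lemma setIntegral_Ioi_pos {f : ℝ → ℝ} (hfi : IntegrableOn f (Ioi 0)) (hf : ∀ x, 0 ≤ f x)
    (hpos : ∀ x ∈ Ioo (1 : ℝ) 2, f x ≠ 0) : 0 < ∫ x in Ioi 0, f x := by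
  rw [setIntegral_pos_iff_support_of_nonneg_ae (ae_of_all _ hf) hfi]
  refine lt_of_lt_of_le ?_ (measure_mono (s := Ioo (1 : ℝ) 2)
    fun x hx => ⟨hpos x hx, zero_lt_one.trans hx.1⟩)
  simp

lemma integrable_pow_mul_gaussian (k : ℕ) :
    Integrable fun x : ℝ => x ^ k * Real.exp (-Real.pi * x ^ 2) := by
  simpa only [Real.rpow_natCast] using
    integrable_rpow_mul_exp_neg_mul_sq Real.pi_pos (s := k)
      (lt_of_lt_of_le (by norm_num) k.cast_nonneg)

lemma hasDerivAt_pow_mul_gaussian (k : ℕ) (x : ℝ) :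
    HasDerivAt (fun x : ℝ => x ^ (k + 1) * Real.exp (-Real.pi * x ^ 2))
      ((k + 1) * (x ^ k * Real.exp (-Real.pi * x ^ 2))
        - 2 * Real.pi * (x ^ (k + 2) * Real.exp (-Real.pi * x ^ 2))) x := by
  have := (hasDerivAt_pow (k + 1) x).mul (((hasDerivAt_pow 2 x).const_mul (-Real.pi)).exp)
  refine this.congr_deriv ?_
  push_cast
  ring

lemma η_eq : η = fun x => Real.pi ^ 2 * (x ^ 4 * Real.exp (-Real.pi * x ^ 2))
    - 3 / 2 * Real.pi * (x ^ 2 * Real.exp (-Real.pi * x ^ 2)) := by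
  ext x
  rw [η]
  ring

lemma continuous_η : Continuous η := by
  unfold η
  fun_prop

lemma integrable_η : Integrable η := by
  rw [η_eq]
  exact ((integrable_pow_mul_gaussian 4).const_mul _).sub
    ((integrable_pow_mul_gaussian 2).const_mul _)

lemma pow_mul_exp_neg_le {y : ℝ} (hy : 0 ≤ y) (k : ℕ) :
    y ^ k * Real.exp (-y) ≤ k.factorial := by
  have h := Real.pow_div_factorial_le_exp y hy k
  rw [div_le_iff₀ (by positivity)] at h
  rw [Real.exp_neg, ← div_eq_mul_inv, div_le_iff₀ (Real.exp_pos y)]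
  linarith

lemma sq_mul_gaussian_le {x : ℝ} (hx : x ≠ 0) :
    x ^ 2 * Real.exp (-Real.pi * x ^ 2) ≤ 2 / x ^ 2 := by
  have h := pow_mul_exp_neg_le (y := Real.pi * x ^ 2) (by positivity) 2
  rw [le_div_iff₀ (by positivity)]
  norm_num [← neg_mul] at h
  have hpi : 1 ≤ Real.pi ^ 2 := by nlinarith [Real.pi_gt_three]
  nlinarith [mul_nonneg (sub_nonneg.2 hpi)
    (mul_nonneg (by positivity : 0 ≤ x ^ 4) (Real.exp_nonneg (-Real.pi * x ^ 2)))]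

lemma abs_η_le {x : ℝ} (hx : x ≠ 0) : |η x| ≤ 9 / x ^ 2 := by
  have h2 := pow_mul_exp_neg_le (y := Real.pi * x ^ 2) (by positivity) 2
  have h3 := pow_mul_exp_neg_le (y := Real.pi * x ^ 2) (by positivity) 3
  norm_num [← neg_mul, Nat.factorial] at h2 h3
  have hx2 : 0 < x ^ 2 := by positivity
  have hxy : x ^ 2 ≤ Real.pi * x ^ 2 := by nlinarith [Real.pi_gt_three]
  rw [le_div_iff₀ hx2, η]
  generalize -Real.pi * x ^ 2 = z at *
  generalize Real.pi * x ^ 2 = y at *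
  have hy : 0 < y := hx2.trans_le hxy
  have he := Real.exp_pos z
  rw [abs_mul, abs_mul, abs_of_pos hy, abs_of_pos he]
  have habs : |y - 3 / 2| ≤ y + 3 / 2 := by rw [abs_le]; constructor <;> linarith
  calc y * |y - 3 / 2| * Real.exp z * x ^ 2
      ≤ y * (y + 3 / 2) * Real.exp z * y := by gcongr
    _ ≤ 9 := by linarith

lemma summable_one_div_add_one_sq : Summable fun n : ℕ => 1 / ((n : ℝ) + 1) ^ 2 := by
  exact_mod_cast (summable_nat_add_iff 1).2 (Real.summable_one_div_nat_pow.2 one_lt_two)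

lemma abs_η_mul_le {lam : ℝ} (hlam : 0 < lam) (n : ℕ) :
    |η (((n : ℝ) + 1) * lam)| ≤ 9 / lam ^ 2 * (1 / ((n : ℝ) + 1) ^ 2) := by
  refine (abs_η_le (by positivity)).trans_eq ?_
  field_simp

lemma summable_abs_η {lam : ℝ} (hlam : 0 < lam) :
    Summable fun n : ℕ => |η (((n : ℝ) + 1) * lam)| :=
  .of_nonneg_of_le (fun _ => abs_nonneg _) (abs_η_mul_le hlam)
    (summable_one_div_add_one_sq.mul_left _)

lemma summable_sq_mul_gaussian {ε : ℝ} (hε : 0 < ε) : Summable fun n : ℕ =>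
    (((n : ℝ) + 1) * ε) ^ 2 * Real.exp (-Real.pi * (((n : ℝ) + 1) * ε) ^ 2) := by
  refine .of_nonneg_of_le (fun _ => by positivity) (fun n => ?_)
    (summable_one_div_add_one_sq.mul_left (2 / ε ^ 2))
  refine (sq_mul_gaussian_le (by positivity)).trans_eq ?_
  field_simp

lemma hasDerivAt_η_primitive (x : ℝ) : HasDerivAt
    (fun x : ℝ => -(Real.pi / 2) * (x ^ 3 * Real.exp (-Real.pi * x ^ 2))) (η x) x := by
  refine ((hasDerivAt_pow_mul_gaussian 2 x).const_mul _).congr_deriv ?_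
  rw [η_eq]
  push_cast
  ring

lemma tendsto_cube_mul_gaussian_atTop :
    Tendsto (fun x : ℝ => x ^ 3 * Real.exp (-Real.pi * x ^ 2)) atTop (𝓝 0) := by
  have hd (x : ℝ) := hasDerivAt_pow_mul_gaussian 2 x
  refine tendsto_zero_of_hasDerivAt_of_integrableOn_Ioi (a := 0) (fun x _ => hd x) ?_ ?_
  · exact (((integrable_pow_mul_gaussian 2).const_mul _).sub
      ((integrable_pow_mul_gaussian 4).const_mul _)).integrableOn
  · exact (integrable_pow_mul_gaussian 3).integrableOn

lemma integral_Ioi_η (a : ℝ) :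
    ∫ x in Ioi a, η x = Real.pi / 2 * (a ^ 3 * Real.exp (-Real.pi * a ^ 2)) := by
  rw [integral_Ioi_of_hasDerivAt_of_tendsto' (fun x _ => hasDerivAt_η_primitive x)
    integrable_η.integrableOn (tendsto_cube_mul_gaussian_atTop.const_mul _)]
  ring

lemma integral_Ioi_η_mul (n : ℕ) (a : ℝ) :
    ∫ lam in Ioi a, η (((n : ℝ) + 1) * lam) = Real.pi / 2 * (a *
      ((((n : ℝ) + 1) * a) ^ 2 * Real.exp (-Real.pi * (((n : ℝ) + 1) * a) ^ 2))) := by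
  rw [integral_comp_mul_left_Ioi _ _ (by positivity), integral_Ioi_η, smul_eq_mul]
  field_simp

lemma integrable_η_mul (n : ℕ) : Integrable fun lam => η (((n : ℝ) + 1) * lam) :=
  integrable_η.comp_mul_left' (by positivity)

lemma exists_abs_tsum_η_le :
    ∃ C, ∀ lam : ℝ, 0 < lam → |∑' n : ℕ, η (((n : ℝ) + 1) * lam)| ≤ C := by
  let η' : ℝ → ℝ := fun x =>
    Real.pi ^ 2 * (((3 : ℕ) + 1) * (x ^ 3 * Real.exp (-Real.pi * x ^ 2))
        - 2 * Real.pi * (x ^ (3 + 2) * Real.exp (-Real.pi * x ^ 2)))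
      - 3 / 2 * Real.pi * (((1 : ℕ) + 1) * (x ^ 1 * Real.exp (-Real.pi * x ^ 2))
        - 2 * Real.pi * (x ^ (1 + 2) * Real.exp (-Real.pi * x ^ 2)))
  have hd (x : ℝ) : HasDerivAt η (η' x) x := by
    rw [η_eq]
    exact ((hasDerivAt_pow_mul_gaussian 3 x).const_mul _).sub
      ((hasDerivAt_pow_mul_gaussian 1 x).const_mul _)
  have hi : Integrable η' :=
    ((((integrable_pow_mul_gaussian 3).const_mul _).sub
      ((integrable_pow_mul_gaussian 5).const_mul _)).const_mul _).sub
    ((((integrable_pow_mul_gaussian 1).const_mul _).sub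
      ((integrable_pow_mul_gaussian 3).const_mul _)).const_mul _)
  refine ⟨∫ x in Ioi 0, |η' x|, fun lam hlam => ?_⟩
  have h := abs_mul_tsum_sub_integral_Ioi_le hd (by fun_prop) integrable_η.integrableOn
    hi.integrableOn hlam (summable_abs_η hlam).of_abs
  rw [integral_Ioi_η] at h
  simp only [ne_eq, OfNat.ofNat_ne_zero, not_false_eq_true, zero_pow, zero_mul, mul_zero,
    sub_zero, abs_mul, abs_of_pos hlam] at h
  exact le_of_mul_le_mul_left h hlam

lemma integrableOn_Ioi_inv_sq {a : ℝ} (ha : 0 < a) (c : ℝ) :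
    IntegrableOn (fun x : ℝ => c / x ^ 2) (Ioi a) := by
  have h := (integrableOn_Ioi_rpow_of_lt (a := -2) (by norm_num) ha).const_mul c
  refine IntegrableOn.congr_fun h (fun x hx => ?_) measurableSet_Ioi
  have hx0 : 0 < x := ha.trans hx
  simp only [Real.rpow_neg hx0.le, div_eq_mul_inv]
  norm_cast

lemma measurable_tsum_η : Measurable fun lam : ℝ => ∑' n : ℕ, η (((n : ℝ) + 1) * lam) := by
  have := continuous_η.measurable
  fun_prop

lemma integrableOn_tsum_η :
    IntegrableOn (fun lam => ∑' n : ℕ, η (((n : ℝ) + 1) * lam)) (Ioi (0 : ℝ)) := by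
  obtain ⟨C, hC⟩ := exists_abs_tsum_η_le
  rw [← Ioc_union_Ioi_eq_Ioi zero_le_one]
  refine IntegrableOn.union ?_ ?_
  · refine Measure.integrableOn_of_bounded (M := C) (by simp)
      measurable_tsum_η.aestronglyMeasurable ?_
    exact (ae_restrict_iff' measurableSet_Ioc).2 (ae_of_all _ fun x hx => hC x hx.1)
  · refine (integrableOn_Ioi_inv_sq one_pos (9 * ∑' n : ℕ, 1 / ((n : ℝ) + 1) ^ 2)).mono'
      measurable_tsum_η.aestronglyMeasurable ?_
    refine (ae_restrict_iff' measurableSet_Ioi).2 (ae_of_all _ fun x hx => ?_)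
    have hx0 : 0 < x := one_pos.trans hx
    refine (tsum_of_norm_bounded (summable_one_div_add_one_sq.hasSum.mul_left (9 / x ^ 2))
      (abs_η_mul_le hx0)).trans_eq ?_
    ring

lemma integral_Ioi_tsum_η {ε : ℝ} (hε : 0 < ε) :
    ∫ lam in Ioi ε, ∑' n : ℕ, η (((n : ℝ) + 1) * lam) = Real.pi / 2 * (ε * ∑' n : ℕ,
      (((n : ℝ) + 1) * ε) ^ 2 * Real.exp (-Real.pi * (((n : ℝ) + 1) * ε) ^ 2)) := by
  rw [← integral_tsum_of_summable_integral_norm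
    (fun n => (integrable_η_mul n).integrableOn)]
  · simp_rw [integral_Ioi_η_mul, tsum_mul_left]
  · refine .of_nonneg_of_le (fun _ => integral_nonneg fun _ => norm_nonneg _) (fun n => ?_)
      (summable_one_div_add_one_sq.mul_left (∫ x in Ioi ε, 9 / x ^ 2))
    rw [← integral_mul_const]
    refine setIntegral_mono_on (integrable_η_mul n).norm.integrableOn
      ((integrableOn_Ioi_inv_sq hε 9).mul_const _) measurableSet_Ioi fun x hx => ?_
    exact abs_η_mul_le (hε.trans hx) n

lemma integral_Ioi_zero_tsum_η :
    ∫ lam in Ioi (0 : ℝ), ∑' n : ℕ, η (((n : ℝ) + 1) * lam) =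
      Real.pi / 2 * ∫ x in Ioi (0 : ℝ), x ^ 2 * Real.exp (-Real.pi * x ^ 2) := by
  obtain ⟨C, hC⟩ := exists_abs_tsum_η_le
  have hRiemann (ε : ℝ) (hε : 0 < ε) := abs_mul_tsum_sub_integral_Ioi_le
    (hasDerivAt_pow_mul_gaussian 1) (by fun_prop)
    (integrable_pow_mul_gaussian 2).integrableOn
    (((integrable_pow_mul_gaussian 1).const_mul _).sub
      ((integrable_pow_mul_gaussian 3).const_mul _)).integrableOn hε
    (summable_sq_mul_gaussian hε)
  set V := ∫ x in Ioi (0 : ℝ), |((1 : ℕ) + 1) * (x ^ 1 * Real.exp (-Real.pi * x ^ 2))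
        - 2 * Real.pi * (x ^ (1 + 2) * Real.exp (-Real.pi * x ^ 2))|
  have hbound (ε : ℝ) (hε : 0 < ε) :
      |(∫ lam in Ioi (0 : ℝ), ∑' n : ℕ, η (((n : ℝ) + 1) * lam)) -
        Real.pi / 2 * ∫ x in Ioi (0 : ℝ), x ^ 2 * Real.exp (-Real.pi * x ^ 2)|
      ≤ (C + Real.pi / 2 * V) * ε := by
    have hsplit := setIntegral_union (Ioc_disjoint_Ioi_same (a := (0 : ℝ)) (b := ε))
      measurableSet_Ioi (integrableOn_tsum_η.mono_set Ioc_subset_Ioi_self)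
      (integrableOn_tsum_η.mono_set (Ioi_subset_Ioi hε.le))
    rw [Ioc_union_Ioi_eq_Ioi hε.le] at hsplit
    have hsmall : |∫ lam in Ioc 0 ε, ∑' n : ℕ, η (((n : ℝ) + 1) * lam)| ≤ C * ε := by
      have := norm_setIntegral_le_of_norm_le_const (μ := volume) (s := Ioc 0 ε)
        (f := fun lam => ∑' n : ℕ, η (((n : ℝ) + 1) * lam)) (C := C) (by simp)
        (fun x hx => hC x hx.1)
      simpa [hε.le] using this
    rw [hsplit, integral_Ioi_tsum_η hε, add_sub_assoc, ← mul_sub, add_mul]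
    refine (abs_add_le _ _).trans (add_le_add hsmall ?_)
    rw [abs_mul, abs_of_pos (by positivity : 0 < Real.pi / 2), mul_assoc, mul_comm V]
    gcongr
    exact hRiemann ε hε
  have hlim : Tendsto (fun ε : ℝ => (C + Real.pi / 2 * V) * ε) (𝓝[>] 0) (𝓝 0) := by
    have : Continuous fun ε : ℝ => (C + Real.pi / 2 * V) * ε := by fun_prop
    simpa using (this.tendsto 0).mono_left nhdsWithin_le_nhds
  have := ge_of_tendsto hlim (eventually_nhdsWithin_of_forall hbound)
  exact sub_eq_zero.1 (abs_nonpos_iff.1 this)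

lemma integral_Ioi_abs_η_pos : 0 < ∫ x in Ioi (0 : ℝ), |η x| := by
  refine setIntegral_Ioi_pos integrable_η.abs.integrableOn (fun x => abs_nonneg _) fun x hx => ?_
  have hx1 : 1 < x := hx.1
  have : 0 < Real.pi * x ^ 2 - 3 / 2 := by
    nlinarith [Real.pi_gt_three, one_lt_pow₀ hx1 two_ne_zero]
  have hx0 : 0 < x := one_pos.trans hx1
  rw [η]
  positivity

/-- Failure of Fubini: for `η(x) = π x²(π x² − 3/2)e^{−π x²}` each integral
`∫₀^∞ η(nλ) dλ` vanishes (`n ≥ 1`), the series of absolute integrals diverges, while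
`λ ↦ Σ_{n≥1} η(nλ)` is integrable on `(0,∞)` with nonzero integral. -/
theorem fubini_failure :
    (∀ n : ℕ, 1 ≤ n → (∫ lam in Set.Ioi (0 : ℝ), η ((n : ℝ) * lam)) = 0) ∧
    ¬ Summable (fun n : ℕ => ∫ lam in Set.Ioi (0 : ℝ), |η (((n : ℝ) + 1) * lam)|) ∧
    IntegrableOn (fun lam => ∑' n : ℕ, η (((n : ℝ) + 1) * lam)) (Set.Ioi (0 : ℝ)) ∧
    (∫ lam in Set.Ioi (0 : ℝ), (∑' n : ℕ, η (((n : ℝ) + 1) * lam))) ≠ 0 := by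
  refine ⟨fun n hn => ?_, fun hs => ?_, integrableOn_tsum_η, ?_⟩
  · obtain ⟨m, rfl⟩ := Nat.exists_eq_add_of_le' hn
    simpa using integral_Ioi_η_mul m 0
  · have hscale (n : ℕ) : ∫ lam in Ioi (0 : ℝ), |η (((n : ℝ) + 1) * lam)| =
        ((n : ℝ) + 1)⁻¹ * ∫ x in Ioi (0 : ℝ), |η x| := by
      simpa using integral_comp_mul_left_Ioi (fun x => |η x|) 0
        (by positivity : 0 < (n : ℝ) + 1)
    simp_rw [hscale] at hs
    rw [summable_mul_right_iff integral_Ioi_abs_η_pos.ne'] at hs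
    exact Real.not_summable_natCast_inv ((summable_nat_add_iff 1).1 (by exact_mod_cast hs))
  · rw [integral_Ioi_zero_tsum_η]
    refine (mul_pos (by positivity) (setIntegral_Ioi_pos
      (integrable_pow_mul_gaussian 2).integrableOn (fun x => by positivity) fun x hx => ?_)).ne'
    have hx0 : 0 < x := one_pos.trans hx.1
    positivity
end

section
/- Let η : ℝ → ℝ be η(x) = π x² (π x² − 3/2) e^{−π x²}. For every real s > 1, the function λ ↦ (Σ_{n=1}^∞ η(nλ)) λ^{s−1} is integrable on (0,∞) and ∫₀^∞ (Σ_{n=1}^∞ η(nλ)) λ^{s−1} dλ = (s(s−1)/8) · π^{−s/2} Γ(s/2) ζ(s), where ζ is the Riemann zeta function and Γ the Gamma function (so the Mellin transform equals s(s−1)/8 times the completed Riemann zeta function). -/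
open MeasureTheory

theorem integrable_tsum_of_summable_integral_norm {α ι E : Type*} [MeasurableSpace α]
    [Countable ι] [NormedAddCommGroup E] [CompleteSpace E] {μ : Measure α} {F : ι → α → E}
    (hF : ∀ i, Integrable (F i) μ) (hsum : Summable fun i ↦ ∫ a, ‖F i a‖ ∂μ) :
    Integrable (fun a ↦ ∑' i, F i a) μ := by
  have hfin : ∫⁻ a, ∑' i, ‖F i a‖ₑ ∂μ ≠ ⊤ := by
    rw [lintegral_tsum fun i ↦ (hF i).1.enorm]
    simp_rw [← ofReal_integral_norm_eq_lintegral_enorm (hF _)]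
    exact hsum.tsum_ofReal_ne_top
  have hae : ∀ᵐ a ∂μ, Summable fun i ↦ F i a := by
    filter_upwards [ae_lt_top' (AEMeasurable.tsum fun i ↦ (hF i).1.enorm) hfin] with a ha
    refine Summable.of_norm ?_
    simpa only [coe_nnnorm] using ENNReal.tsum_coe_ne_top_iff_summable_coe.mp ha.ne
  refine ⟨?_, (lintegral_mono fun a ↦ enorm_tsum_le_tsum_enorm).trans_lt hfin.lt_top⟩
  refine aestronglyMeasurable_of_tendsto_ae Filter.atTop
    (f := fun (t : Finset ι) a ↦ ∑ i ∈ t, F i a) (fun t ↦ ?_) ?_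
  · exact (integrable_finsetSum t fun i _ ↦ hF i).1
  · filter_upwards [hae] with a ha using ha.hasSum

theorem η_mul_rpow {s x : ℝ} (hx : 0 < x) :
    η x * x ^ (s - 1) =
      Real.pi ^ 2 * (x ^ (s + 3) * Real.exp (-Real.pi * x ^ (2 : ℝ))) -
        3 / 2 * Real.pi * (x ^ (s + 1) * Real.exp (-Real.pi * x ^ (2 : ℝ))) := by
  have h3 : x ^ (s + 3) = x ^ (s - 1) * x ^ 4 := by
    rw [← Real.rpow_natCast, ← Real.rpow_add hx]; congr 1; push_cast; ring
  have h1 : x ^ (s + 1) = x ^ (s - 1) * x ^ 2 := by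
    rw [← Real.rpow_natCast, ← Real.rpow_add hx]; congr 1; push_cast; ring
  rw [h3, h1, Real.rpow_two, η]
  ring

theorem integrableOn_η_mul_rpow {s : ℝ} (hs : 0 < s) :
    IntegrableOn (fun x ↦ η x * x ^ (s - 1)) (Set.Ioi 0) := by
  have h3 := integrableOn_rpow_mul_exp_neg_mul_rpow (p := 2) (s := s + 3) (by linarith) two_pos
    Real.pi_pos
  have h1 := integrableOn_rpow_mul_exp_neg_mul_rpow (p := 2) (s := s + 1) (by linarith) two_pos
    Real.pi_pos
  exact IntegrableOn.congr_fun ((h3.const_mul (Real.pi ^ 2)).sub (h1.const_mul (3 / 2 * Real.pi)))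
    (fun x hx ↦ (η_mul_rpow hx).symm) measurableSet_Ioi

theorem integral_η_mul_rpow {s : ℝ} (hs : 0 < s) :
    ∫ x in Set.Ioi (0 : ℝ), η x * x ^ (s - 1) =
      s * (s - 1) / 8 * (Real.pi ^ (-s / 2) * Real.Gamma (s / 2)) := by
  have h3 := integrableOn_rpow_mul_exp_neg_mul_rpow (p := 2) (s := s + 3) (by linarith) two_pos
    Real.pi_pos
  have h1 := integrableOn_rpow_mul_exp_neg_mul_rpow (p := 2) (s := s + 1) (by linarith) two_pos
    Real.pi_pos
  have hp3 : Real.pi ^ (-(s + 3 + 1) / 2) = Real.pi ^ (-s / 2) / Real.pi ^ 2 := by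
    rw [← Real.rpow_natCast, ← Real.rpow_sub Real.pi_pos]; congr 1; push_cast; ring
  have hp1 : Real.pi ^ (-(s + 1 + 1) / 2) = Real.pi ^ (-s / 2) / Real.pi := by
    rw [← Real.rpow_sub_one Real.pi_pos.ne']; congr 1; ring
  have hG1 : Real.Gamma ((s + 1 + 1) / 2) = s / 2 * Real.Gamma (s / 2) := by
    rw [← Real.Gamma_add_one (by positivity)]; congr 1; ring
  have hG3 : Real.Gamma ((s + 3 + 1) / 2) = (s / 2 + 1) * (s / 2 * Real.Gamma (s / 2)) := by
    rw [← Real.Gamma_add_one (by positivity), ← Real.Gamma_add_one (by positivity)]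
    congr 1; ring
  rw [setIntegral_congr_fun measurableSet_Ioi fun x hx ↦ η_mul_rpow hx,
    integral_sub (h3.const_mul _) (h1.const_mul _), integral_const_mul, integral_const_mul,
    integral_rpow_mul_exp_neg_mul_rpow two_pos (by linarith) Real.pi_pos,
    integral_rpow_mul_exp_neg_mul_rpow two_pos (by linarith) Real.pi_pos, hp3, hp1, hG1, hG3]
  have := Real.pi_pos.ne'
  field_simp
  ring

theorem comp_mul_left_mul_rpow (f : ℝ → ℝ) {a s x : ℝ} (ha : 0 < a) (hx : 0 < x) :
    f (a * x) * x ^ (s - 1) = a ^ (1 - s) * (f (a * x) * (a * x) ^ (s - 1)) := by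
  rw [Real.mul_rpow ha.le hx.le, mul_left_comm, ← mul_assoc (a ^ (1 - s)), ← Real.rpow_add ha]
  simp

theorem integrableOn_comp_mul_left_mul_rpow {f : ℝ → ℝ} {a s : ℝ} (ha : 0 < a)
    (hf : IntegrableOn (fun x ↦ f x * x ^ (s - 1)) (Set.Ioi 0)) :
    IntegrableOn (fun x ↦ f (a * x) * x ^ (s - 1)) (Set.Ioi 0) := by
  have h := (integrableOn_Ioi_comp_mul_left_iff (fun x ↦ f x * x ^ (s - 1)) 0 ha).mpr
    (by rwa [mul_zero])
  exact IntegrableOn.congr_fun (h.const_mul (a ^ (1 - s)))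
    (fun x hx ↦ (comp_mul_left_mul_rpow f ha hx).symm) measurableSet_Ioi

theorem integral_comp_mul_left_mul_rpow (f : ℝ → ℝ) {a : ℝ} (s : ℝ) (ha : 0 < a) :
    ∫ x in Set.Ioi (0 : ℝ), f (a * x) * x ^ (s - 1) =
      1 / a ^ s * ∫ x in Set.Ioi (0 : ℝ), f x * x ^ (s - 1) := by
  rw [setIntegral_congr_fun measurableSet_Ioi fun x hx ↦ comp_mul_left_mul_rpow f ha hx,
    integral_const_mul, integral_comp_mul_left_Ioi (fun x ↦ f x * x ^ (s - 1)) 0 ha, mul_zero,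
    smul_eq_mul, ← mul_assoc, sub_eq_neg_add, Real.rpow_add_one ha.ne', Real.rpow_neg ha.le,
    mul_assoc _ a, mul_inv_cancel₀ ha.ne', mul_one, one_div]

/-- For `s > 1` the Mellin transform of `λ ↦ Σ_{n≥1} η(nλ)` exists and equals
`(s(s−1)/8) · π^{−s/2} Γ(s/2) ζ(s)`, i.e. `s(s−1)/8` times the completed Riemann zeta
function. -/
theorem mellin_eq_completed_zeta (s : ℝ) (hs : 1 < s) :
    IntegrableOn (fun lam => (∑' n : ℕ, η (((n : ℝ) + 1) * lam)) * lam ^ (s - 1))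
      (Set.Ioi (0 : ℝ)) ∧
    Complex.ofReal
        (∫ lam in Set.Ioi (0 : ℝ), (∑' n : ℕ, η (((n : ℝ) + 1) * lam)) * lam ^ (s - 1))
      = ((s : ℂ) * ((s : ℂ) - 1) / 8) * completedRiemannZeta (s : ℂ) := by
  have hs0 : 0 < s := by linarith
  have hn (n : ℕ) : (0 : ℝ) < n + 1 := by positivity
  have hint (n : ℕ) := integrableOn_comp_mul_left_mul_rpow (hn n) (integrableOn_η_mul_rpow hs0)
  have hzeta : Summable fun n : ℕ ↦ 1 / ((n : ℝ) + 1) ^ s := by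
    simpa using (summable_nat_add_iff 1).mpr (Real.summable_one_div_nat_rpow.mpr hs)
  have hsum : Summable fun n : ℕ ↦
      ∫ x in Set.Ioi (0 : ℝ), ‖η (((n : ℝ) + 1) * x) * x ^ (s - 1)‖ := by
    refine (hzeta.mul_right (∫ x in Set.Ioi (0 : ℝ), |η x| * x ^ (s - 1))).congr fun n ↦ ?_
    rw [← integral_comp_mul_left_mul_rpow (fun x ↦ |η x|) s (hn n)]
    refine setIntegral_congr_fun measurableSet_Ioi fun x (hx : 0 < x) ↦ ?_
    simp only [norm_mul, Real.norm_eq_abs, abs_of_pos (Real.rpow_pos_of_pos hx _)]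
  simp_rw [← tsum_mul_right]
  refine ⟨integrable_tsum_of_summable_integral_norm hint hsum, ?_⟩
  rw [← integral_tsum_of_summable_integral_norm hint hsum]
  simp_rw [integral_comp_mul_left_mul_rpow η s (hn _)]
  have hre : 1 < (s : ℂ).re := by simpa using hs
  rw [tsum_mul_right, integral_η_mul_rpow hs0, completedZeta_eq_tsum_of_one_lt_re hre,
    ← zeta_eq_tsum_one_div_nat_cpow hre, zeta_eq_tsum_one_div_nat_add_one_cpow hre]
  have hG : Complex.Gamma (s / 2) = (Real.Gamma (s / 2) : ℂ) := by
    rw [← Complex.Gamma_ofReal]; push_cast; rfl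
  have hpi : (Real.pi : ℂ) ^ (-(s : ℂ) / 2) = ((Real.pi ^ (-s / 2) : ℝ) : ℂ) := by
    rw [Complex.ofReal_cpow Real.pi_pos.le]; push_cast; rfl
  have hterm (n : ℕ) : 1 / ((n : ℂ) + 1) ^ (s : ℂ) = ((1 / ((n : ℝ) + 1) ^ s : ℝ) : ℂ) := by
    rw [Complex.ofReal_div, Complex.ofReal_cpow (hn n).le]; push_cast; rfl
  rw [hG, hpi, tsum_congr hterm, ← Complex.ofReal_tsum]
  push_cast
  ring
end
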